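/- Let w ∈ E⁺ have a minimal r-factorisation w = p₁⋯pₘ, let e be the first letter of p₁, and suppose ē 𝓡 p̄₁ in IG(E). Then w̄ 𝓡̃ ē in IG(E). Dually, if f is the last letter of pₘ and f̄ 𝓛 p̄ₘ, then w̄ 𝓛̃ f̄. -/

import Mathlib

section Green

variable {T : Type*} [Semigroup T]

/-- Green's relation 𝓡. -/
def GreenR (a b : T) : Prop := a = b ∨ ∃ x y : T, a * x = b ∧ b * y = a

/-- Green's relation 𝓛. -/
def GreenL (a b : T) : Prop := a = b ∨ ∃ x y : T, x * a = b ∧ y * b = a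

/-- Green's relation 𝓓 = 𝓡 ∘ 𝓛. -/
def GreenD (a b : T) : Prop := ∃ c : T, GreenR a c ∧ GreenL c b

/-- An element is regular if `a = a * b * a` for some `b`. -/
def IsRegularElem (a : T) : Prop := ∃ b : T, a * b * a = a

/-- The principal two-sided ideal `T¹ a T¹`. -/
def principalIdeal (a : T) : Set T :=
  {x | x = a ∨ (∃ u, u * a = x) ∨ (∃ v, a * v = x) ∨ ∃ u v, u * a * v = x}

/-- Green's relation 𝓙. -/
def GreenJ (a b : T) : Prop := principalIdeal a = principalIdeal b

/-- The 𝓙-preorder. -/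
def JleRel (a b : T) : Prop := principalIdeal a ⊆ principalIdeal b

/-- Strict 𝓙-order. -/
def JltRel (a b : T) : Prop := JleRel a b ∧ ¬ JleRel b a

/-- `u` is a (two-sided) identity element. -/
def IsIdentityElem (u : T) : Prop := ∀ x : T, u * x = x ∧ x * u = x

/-- The relation 𝓡̃. -/
def RTilde (a b : T) : Prop := ∀ ε : T, ε * ε = ε → (ε * a = a ↔ ε * b = b)

/-- The relation 𝓛̃. -/
def LTilde (a b : T) : Prop := ∀ ε : T, ε * ε = ε → (a * ε = a ↔ b * ε = b)

/-- `blockProd p i k = p i * p (i+1) * ⋯ * p (i+k)`. -/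
def blockProd (p : ℕ → T) (i : ℕ) : ℕ → T
  | 0 => p i
  | k + 1 => blockProd p i k * p (i + (k + 1))

/-- Multiply `x` by optional (possibly empty) words on both sides. -/
def withCtx (u : Option T) (x : T) (v : Option T) : T :=
  match u, v with
  | none, none => x
  | some u', none => u' * x
  | none, some v' => x * v'
  | some u', some v' => u' * x * v'

/-- Multiply by an optional word on the left. -/
def leftCtx (u : Option T) (x : T) : T := match u with | none => x | some u' => u' * x

/-- Multiply by an optional word on the right. -/
def rightCtx (x : T) (v : Option T) : T := match v with | none => x | some v' => x * v'

end Green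

section IGdef

/-- The set of idempotents of `S`. -/
abbrev IdemE (S : Type*) [Semigroup S] : Type _ := {x : S // x * x = x}

variable {S : Type*} [Semigroup S]

/-- `e, f` form a basic pair if `{e,f} ∩ {ef,fe} ≠ ∅`. -/
def BasicPair (e f : IdemE S) : Prop :=
  (e : S) * f = e ∨ (e : S) * f = f ∨ (f : S) * e = e ∨ (f : S) * e = f

/-- The defining relations of IG(E): `ef = g` whenever `e, f` is a basic pair with
product `g` in `S`. -/
def igRelBase (u v : FreeSemigroup (IdemE S)) : Prop :=
  ∃ e f g : IdemE S, BasicPair e f ∧ (g : S) = (e : S) * (f : S) ∧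
    u = FreeSemigroup.of e * FreeSemigroup.of f ∧ v = FreeSemigroup.of g

/-- The congruence on the free semigroup `E⁺` generated by the defining relations. -/
def igCon (S : Type*) [Semigroup S] : Con (FreeSemigroup (IdemE S)) :=
  conGen (fun u v => igRelBase u v)

/-- The free idempotent generated semigroup IG(E). -/
abbrev IG (S : Type*) [Semigroup S] := (igCon S).Quotient

/-- `w̄`, the image of a word `w ∈ E⁺` in IG(E). -/
def igBar (w : FreeSemigroup (IdemE S)) : IG S := (w : (igCon S).Quotient)

/-- The list of letters of a word. -/
def wordList (w : FreeSemigroup (IdemE S)) : List (IdemE S) := w.head :: w.tail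

/-- The length of a word. -/
def wlen (w : FreeSemigroup (IdemE S)) : ℕ := (wordList w).length

/-- Length of an optional word. -/
def olen (u : Option (FreeSemigroup (IdemE S))) : ℕ :=
  match u with | none => 0 | some u' => wlen u'

/-- `p 1, …, p m` is an r-factorisation of `w`: each factor represents a regular
element of IG(E). -/
def IsRFact (w : FreeSemigroup (IdemE S)) (m : ℕ) (p : ℕ → FreeSemigroup (IdemE S)) : Prop :=
  1 ≤ m ∧ blockProd p 1 (m - 1) = w ∧ ∀ i, 1 ≤ i → i ≤ m → IsRegularElem (igBar (p i))

/-- A minimal r-factorisation: no product of two or more consecutive factors is regular. -/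
def IsMinRFact (w : FreeSemigroup (IdemE S)) (m : ℕ) (p : ℕ → FreeSemigroup (IdemE S)) : Prop :=
  IsRFact w m p ∧
    ∀ i j, 1 ≤ i → i < j → j ≤ m → ¬ IsRegularElem (igBar (blockProd p i (j - i)))

/-- The relation ≈ on m-tuples of words. -/
def TupleApprox (m : ℕ) (p q : ℕ → FreeSemigroup (IdemE S)) : Prop :=
  (∃ i, 1 ≤ i ∧ i ≤ m ∧ igBar (p i) = igBar (q i) ∧
    ∀ j, 1 ≤ j → j ≤ m → j ≠ i → p j = q j) ∨
  (∃ i, ∃ e : IdemE S, 1 ≤ i ∧ i < m ∧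
    igBar (p i) = igBar (q i * FreeSemigroup.of e) ∧
    igBar (q (i + 1)) = igBar (FreeSemigroup.of e * p (i + 1)) ∧
    ∀ j, 1 ≤ j → j ≤ m → j ≠ i → j ≠ i + 1 → p j = q j) ∨
  (∃ i, ∃ e : IdemE S, 1 ≤ i ∧ i < m ∧
    igBar (q i) = igBar (p i * FreeSemigroup.of e) ∧
    igBar (p (i + 1)) = igBar (FreeSemigroup.of e * q (i + 1)) ∧
    ∀ j, 1 ≤ j → j ≤ m → j ≠ i → j ≠ i + 1 → p j = q j)

/-- The relation ∼: the transitive closure of ≈. -/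
def TupleSim (m : ℕ) (p q : ℕ → FreeSemigroup (IdemE S)) : Prop :=
  Relation.TransGen (TupleApprox m) p q

/-- One application of a defining relation of IG(E) inside a word. -/
def RewriteStep (w w' : FreeSemigroup (IdemE S)) : Prop :=
  ∃ (u v : Option (FreeSemigroup (IdemE S))) (x y : FreeSemigroup (IdemE S)),
    (igRelBase x y ∨ igRelBase y x) ∧ w = withCtx u x v ∧ w' = withCtx u y v

/-- `e` is a seed of `w` at (1-based) position `k`. -/
def SeedAt (w : FreeSemigroup (IdemE S)) (e : IdemE S) (k : ℕ) : Prop :=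
  ∃ u v : Option (FreeSemigroup (IdemE S)),
    w = withCtx u (FreeSemigroup.of e) v ∧ k = olen u + 1 ∧
    GreenL (igBar (leftCtx u (FreeSemigroup.of e))) (igBar (FreeSemigroup.of e)) ∧
    GreenR (igBar (FreeSemigroup.of e)) (igBar (rightCtx (FreeSemigroup.of e) v))

/-- The coordinate (position within `w` of the first letter) of the `i`-th factor. -/
def wcoord (p : ℕ → FreeSemigroup (IdemE S)) (i : ℕ) : ℕ :=
  1 + ∑ j ∈ Finset.Ico 1 i, wlen (p j)

end IGdef

/-- The first letter of a word. -/
def firstLetter {S : Type*} [Semigroup S] (w : FreeSemigroup (IdemE S)) : IdemE S := w.head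

/-- The last letter of a word. -/
def lastLetter {S : Type*} [Semigroup S] (w : FreeSemigroup (IdemE S)) : IdemE S :=
  w.tail.getLastD w.head

section ListValues

open MulOpposite

variable {α M : Type*} [Monoid M]

/-- The value of a list of letters in a monoid. -/
def listVal (φ : α → M) (l : List α) : M := (l.map φ).prod

@[simp] lemma listVal_nil (φ : α → M) : listVal φ [] = 1 := rfl

@[simp] lemma listVal_cons (φ : α → M) (a : α) (l : List α) :
    listVal φ (a :: l) = φ a * listVal φ l := by simp [listVal]

@[simp] lemma listVal_append (φ : α → M) (l l' : List α) :
    listVal φ (l ++ l') = listVal φ l * listVal φ l' := by simp [listVal]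

lemma listVal_op_reverse (φ : α → M) (l : List α) :
    listVal (fun a => op (φ a)) l.reverse = op (listVal φ l) := by
  induction l with
  | nil => rfl
  | cons a l ih => simp [ih]

/-- The letters `a`, `b` multiply to the letter `k`, and one of them absorbs the other. -/
def LetterRel (φ : α → M) (a b k : α) : Prop :=
  φ a * φ b = φ k ∧ (φ a * φ b * φ a = φ a ∨ φ b * φ a * φ b = φ b)

lemma LetterRel.op {φ : α → M} {a b k : α} (h : LetterRel φ a b k) :
    LetterRel (fun a => op (φ a)) b a k := by
  refine ⟨by simp [← op_mul, h.1], h.2.symm.imp ?_ ?_⟩ <;> intro h <;>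
    simpa [← op_mul, mul_assoc] using h

lemma append_eq_append_cons {u r x y : List α} {k : α} (h : u ++ r = x ++ k :: y) :
    (∃ x', x = u ++ x' ∧ r = x' ++ k :: y) ∨ ∃ u', u = x ++ k :: u' ∧ y = u' ++ r := by
  rcases List.append_eq_append_iff.1 h with ⟨x', hx, hr⟩ | ⟨u', hu, hr⟩
  · exact .inl ⟨x', hx, hr⟩
  · cases u' with
    | nil => exact .inl ⟨[], by simpa using hu.symm, by simpa using hr.symm⟩
    | cons c u' =>
      simp only [List.cons_append, List.cons.injEq] at hr
      obtain ⟨rfl, rfl⟩ := hr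
      exact .inr ⟨u', hu, rfl⟩

lemma append_eq_append_cons_cons {u r x y : List α} {a b : α} (h : u ++ r = x ++ a :: b :: y)
    (hn : u.length ≠ x.length + 1) :
    (∃ x', x = u ++ x' ∧ r = x' ++ a :: b :: y) ∨
      ∃ u', u = x ++ a :: b :: u' ∧ y = u' ++ r := by
  rcases append_eq_append_cons h with h | ⟨u', rfl, hy⟩
  · exact .inl h
  · cases u' with
    | nil => simp at hn
    | cons c u' =>
      simp only [List.cons_append, List.cons.injEq] at hy
      obtain ⟨rfl, rfl⟩ := hy
      exact .inr ⟨u', rfl, rfl⟩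

/-- Some prefix of `l` is 𝓛-related to its last letter and is fixed by `ε` on the left. -/
def FixesPrefix (φ : α → M) (ε : M) (l : List α) : Prop :=
  ∃ u h v, l = u ++ h :: v ∧ (∃ y, y * (listVal φ u * φ h) = φ h) ∧
    ε * (listVal φ u * φ h) = listVal φ u * φ h

/-- Some suffix of `l` is 𝓡-related to its first letter and is fixed by `ε` on the right. -/
def FixesSuffix (φ : α → M) (ε : M) (l : List α) : Prop :=
  ∃ u h v, l = u ++ h :: v ∧ (∃ y, φ h * listVal φ v * y = φ h) ∧
    φ h * listVal φ v * ε = φ h * listVal φ v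

lemma fixesSuffix_iff (φ : α → M) (ε : M) (l : List α) :
    FixesSuffix φ ε l ↔ FixesPrefix (fun a => op (φ a)) (op ε) l.reverse := by
  constructor
  · rintro ⟨u, h, v, rfl, ⟨y, hy⟩, hε⟩
    refine ⟨v.reverse, h, u.reverse, by simp, ⟨op y, ?_⟩, ?_⟩ <;>
      simp [listVal_op_reverse, ← op_mul, hy, hε]
  · rintro ⟨u, h, v, hl, ⟨y, hy⟩, hε⟩
    rw [List.reverse_eq_iff] at hl
    rw [← u.reverse_reverse, listVal_op_reverse] at hy hε
    refine ⟨v.reverse, h, u.reverse, by simpa using hl, ⟨unop y, ?_⟩, ?_⟩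
    · apply op_injective
      simpa using hy
    · apply op_injective
      simpa using hε

lemma fixesPrefix_rel {φ : α → M} {a b k : α} (hk : LetterRel φ a b k) (ε : M) (x y : List α) :
    FixesPrefix φ ε (x ++ a :: b :: y) ↔ FixesPrefix φ ε (x ++ k :: y) := by
  obtain ⟨hk, hab⟩ := hk
  constructor
  · rintro ⟨u, h, v, hl, ⟨z, hz⟩, hε⟩
    rcases append_eq_append_cons hl with ⟨r, hu, hr⟩ | ⟨r, rfl, -⟩
    · rcases r with _ | ⟨c, r⟩
      · obtain ⟨rfl, rfl⟩ : a = h ∧ b :: y = v := by simpa using hr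
        obtain rfl : u = x := by simpa using hu
        refine ⟨u, k, y, rfl, ⟨z, ?_⟩, ?_⟩
        · rw [← hk, ← mul_assoc (listVal φ u), ← mul_assoc z, hz]
        · rw [← hk, ← mul_assoc (listVal φ u), ← mul_assoc ε, hε]
      · simp only [List.cons_append, List.cons.injEq] at hr
        obtain ⟨rfl, hr⟩ := hr
        rcases r with _ | ⟨d, r⟩
        · obtain ⟨rfl, rfl⟩ : b = h ∧ y = v := by simpa using hr
          subst hu
          simp only [listVal_append, listVal_cons, listVal_nil, mul_one] at hz hε
          refine ⟨x, k, y, rfl, ⟨φ a * z, ?_⟩, ?_⟩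
          · rw [← hk, mul_assoc, ← mul_assoc (listVal φ x), hz]
          · rw [← hk, ← mul_assoc (listVal φ x), hε]
        · simp only [List.cons_append, List.cons.injEq] at hr
          obtain ⟨rfl, rfl⟩ := hr
          subst hu
          have hv : listVal φ (x ++ a :: b :: r) = listVal φ (x ++ k :: r) := by
            simp [← hk, mul_assoc]
          rw [hv] at hz hε
          exact ⟨x ++ k :: r, h, v, by simp, ⟨z, hz⟩, hε⟩
    · exact ⟨u, h, r ++ k :: y, by simp, ⟨z, hz⟩, hε⟩
  · rintro ⟨u, h, v, hl, ⟨z, hz⟩, hε⟩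
    rcases append_eq_append_cons hl with ⟨r, hu, hr⟩ | ⟨r, rfl, -⟩
    · rcases r with _ | ⟨c, r⟩
      · obtain ⟨rfl, rfl⟩ : k = h ∧ y = v := by simpa using hr
        obtain rfl : u = x := by simpa using hu
        rcases hab with hab | hab
        · have hka : φ k * φ a = φ a := by rw [← hk, hab]
          have hu : listVal φ u * φ a = listVal φ u * φ k * φ a := by rw [mul_assoc, hka]
          refine ⟨u, a, b :: y, rfl, ⟨z, ?_⟩, ?_⟩
          · rw [hu, ← mul_assoc z, hz, hka]
          · rw [hu, ← mul_assoc ε, hε]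
        · have hkb : φ b * φ k = φ b := by rw [← hk, ← mul_assoc, hab]
          have hu : listVal φ (u ++ [a]) * φ b = listVal φ u * φ k := by simp [mul_assoc, hk]
          refine ⟨u ++ [a], b, y, by simp, ⟨φ b * z, ?_⟩, ?_⟩
          · rw [hu, mul_assoc, hz, hkb]
          · rw [hu, hε]
      · simp only [List.cons_append, List.cons.injEq] at hr
        obtain ⟨rfl, rfl⟩ := hr
        subst hu
        have hv : listVal φ (x ++ k :: r) = listVal φ (x ++ a :: b :: r) := by
          simp [← hk, mul_assoc]
        rw [hv] at hz hε
        exact ⟨x ++ a :: b :: r, h, v, by simp, ⟨z, hz⟩, hε⟩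
    · exact ⟨u, h, r ++ a :: b :: y, by simp, ⟨z, hz⟩, hε⟩

lemma fixesSuffix_rel {φ : α → M} {a b k : α} (hk : LetterRel φ a b k) (ε : M) (x y : List α) :
    FixesSuffix φ ε (x ++ a :: b :: y) ↔ FixesSuffix φ ε (x ++ k :: y) := by
  simpa [fixesSuffix_iff] using fixesPrefix_rel hk.op (op ε) y.reverse x.reverse

/-- The factor of `l` between the cuts `i` and `j` is regular, the product of the rest of `l`,
read cyclically, being an inverse. -/
def GoodFactor (φ : α → M) (l : List α) (i j : ℕ) : Prop :=
  ∃ u s v, l = u ++ (s ++ v) ∧ u.length = i ∧ u.length + s.length = j ∧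
    listVal φ s * listVal φ v * listVal φ u * listVal φ s = listVal φ s

lemma GoodFactor.mono {φ : α → M} {l : List α} {i j i' j' : ℕ} (h : GoodFactor φ l i j)
    (hi : i' ≤ i) (hj : j ≤ j') (hj' : j' ≤ l.length) : GoodFactor φ l i' j' := by
  obtain ⟨u, s, v, rfl, rfl, rfl, h⟩ := h
  simp only [List.length_append] at hj'
  obtain ⟨u₁, u₂, rfl, rfl⟩ : ∃ u₁ u₂, u = u₁ ++ u₂ ∧ u₁.length = i' :=
    ⟨u.take i', u.drop i', by simp, by simpa using hi⟩
  obtain ⟨v₁, v₂, rfl, hv⟩ : ∃ v₁ v₂, v = v₁ ++ v₂ ∧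
      v₁.length = j' - ((u₁ ++ u₂).length + s.length) :=
    ⟨v.take (j' - ((u₁ ++ u₂).length + s.length)), v.drop _,
      (List.take_append_drop _ _).symm, by simp at hj' ⊢; omega⟩
  refine ⟨u₁, u₂ ++ s ++ v₁, v₂, by simp, rfl, by simp at hv hj ⊢; omega, ?_⟩
  have := congrArg (fun t => listVal φ u₂ * t * listVal φ v₁) h
  simpa [mul_assoc] using this

lemma GoodFactor.merge {φ : α → M} {x y : List α} {a b k : α} (hk : φ a * φ b = φ k) {i j : ℕ}
    (h : GoodFactor φ (x ++ a :: b :: y) i j) (hi : i ≠ x.length + 1) (hj : j ≠ x.length + 1) :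
    GoodFactor φ (x ++ k :: y) (if i ≤ x.length then i else i - 1)
      (if j ≤ x.length then j else j - 1) := by
  obtain ⟨u, s, v, hl, rfl, rfl, h⟩ := h
  rcases append_eq_append_cons_cons hl.symm hi with ⟨x', rfl, hr⟩ | ⟨u', rfl, rfl⟩
  · rcases append_eq_append_cons_cons hr (by simp at hj; omega) with
      ⟨x', rfl, rfl⟩ | ⟨s', rfl, rfl⟩
    · refine ⟨u, s, x' ++ k :: y, by simp, by simp, by simp, ?_⟩
      simpa [← hk, mul_assoc] using h
    · refine ⟨u, x' ++ k :: s', v, by simp, by simp, by simp; grind, ?_⟩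
      simpa [← hk, mul_assoc] using h
  · refine ⟨x ++ k :: u', s, v, by simp, by simp, by simp; grind, ?_⟩
    simpa [← hk, mul_assoc] using h

lemma GoodFactor.split {φ : α → M} {x y : List α} {a b k : α} (hk : φ a * φ b = φ k) {i j : ℕ}
    (h : GoodFactor φ (x ++ k :: y) i j) :
    GoodFactor φ (x ++ a :: b :: y) (if i ≤ x.length then i else i + 1)
      (if j ≤ x.length then j else j + 1) := by
  obtain ⟨u, s, v, hl, rfl, rfl, h⟩ := h
  rcases append_eq_append_cons hl.symm with ⟨x', rfl, hr⟩ | ⟨u', rfl, rfl⟩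
  · rcases append_eq_append_cons hr with ⟨x', rfl, rfl⟩ | ⟨s', rfl, rfl⟩
    · refine ⟨u, s, x' ++ a :: b :: y, by simp, by simp, by simp, ?_⟩
      simpa [← hk, mul_assoc] using h
    · refine ⟨u, x' ++ a :: b :: s', v, by simp, by simp, by simp; grind, ?_⟩
      simpa [← hk, mul_assoc] using h
  · refine ⟨x ++ a :: b :: u', s, v, by simp, by simp; omega, by simp; grind, ?_⟩
    simpa [← hk, mul_assoc] using h

lemma GoodFactor.shrink_right {φ : α → M} {x y : List α} {a b : α}
    (hab : φ a * φ b * φ a = φ a) {i : ℕ} (hi : i ≤ x.length)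
    (h : GoodFactor φ (x ++ a :: b :: y) i (x.length + 2)) :
    GoodFactor φ (x ++ a :: b :: y) i (x.length + 1) := by
  obtain ⟨u, s, v, hl, rfl, hj, h⟩ := h
  rcases append_eq_append_cons_cons hl.symm (by omega) with ⟨x', rfl, hr⟩ | ⟨u', rfl, rfl⟩
  · obtain ⟨rfl, rfl⟩ : s = x' ++ [a, b] ∧ v = y :=
      List.append_inj (by simpa using hr) (by simp at hj ⊢; omega)
    refine ⟨u, x' ++ [a], b :: v, by simp, rfl, by simp; omega, ?_⟩
    have := congrArg (fun t => t * φ a) h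
    simp only [listVal_append, listVal_cons, listVal_nil, mul_one] at this ⊢
    simp only [mul_assoc] at this hab ⊢
    simpa only [hab] using this
  · simp at hi

lemma GoodFactor.shrink_left {φ : α → M} {x y : List α} {a b : α}
    (hab : φ b * φ a * φ b = φ b) {j : ℕ} (hj : x.length + 2 ≤ j)
    (h : GoodFactor φ (x ++ a :: b :: y) x.length j) :
    GoodFactor φ (x ++ a :: b :: y) (x.length + 1) j := by
  obtain ⟨u, s, v, hl, hu, rfl, h⟩ := h
  obtain ⟨rfl, hr⟩ := List.append_inj hl hu.symm
  rcases append_eq_append_cons_cons (x := []) (by simpa using hr.symm) (by simp; omega) with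
    ⟨x', hx, -⟩ | ⟨s', rfl, rfl⟩
  · obtain ⟨rfl, -⟩ : s = [] ∧ x' = [] := by simpa using hx.symm
    simp at hj
  · refine ⟨x ++ [a], b :: s', v, by simp, by simp, by simp; omega, ?_⟩
    have := congrArg (fun t => φ b * t) h
    simp only [List.nil_append, listVal_append, listVal_cons, listVal_nil, mul_one] at this ⊢
    simp only [← mul_assoc] at this hab ⊢
    simpa only [hab] using this

/-- Some word of value `ε` has a letter `k` generating the same principal left and right ideals
as the prefix, respectively the suffix, that it bounds. -/
def HasSeed (φ : α → M) (ε : M) : Prop :=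
  ∃ u k v, listVal φ (u ++ k :: v) = ε ∧ φ k * listVal φ v * listVal φ u * φ k = φ k

/-- `l` carries `N` marked letters such that any factor bounded by two of them is good. -/
def HasMarks (φ : α → M) (N : ℕ) (l : List α) : Prop :=
  ∃ A : Finset ℕ, A.card = N ∧ (∀ i ∈ A, i < l.length) ∧
    ∀ i ∈ A, ∀ j ∈ A, i < j → GoodFactor φ l i (j + 1)

lemma HasMarks.merge {φ : α → M} {x y : List α} {a b k : α} (hk : φ a * φ b = φ k) {N : ℕ}
    (h : HasMarks φ N (x ++ a :: b :: y)) :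
    HasSeed φ (listVal φ (x ++ k :: y)) ∨ HasMarks φ N (x ++ k :: y) := by
  obtain ⟨A, rfl, hlt, hA⟩ := h
  by_cases hn : x.length ∈ A ∧ x.length + 1 ∈ A
  · left
    have := (hA _ hn.1 _ hn.2 (by omega)).merge hk (by omega) (by omega)
    simp only [le_refl, if_true, show ¬ x.length + 1 + 1 ≤ x.length by omega, if_false] at this
    obtain ⟨u, s, v, hl, hu, hs, h⟩ := this
    obtain ⟨rfl, hr⟩ := List.append_inj hl hu.symm
    obtain ⟨rfl, rfl⟩ : [k] = s ∧ y = v := List.append_inj (by simpa using hr) (by simp; omega)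
    exact ⟨x, k, y, rfl, by simpa using h⟩
  · right
    set f : ℕ → ℕ := fun i => if i ≤ x.length then i else i - 1 with hf
    refine ⟨A.image f, Finset.card_image_of_injOn ?_, ?_, ?_⟩
    · intro i hi j hj hij
      simp only [hf] at hij
      by_contra hne
      apply hn
      have : (i = x.length ∧ j = x.length + 1) ∨ (j = x.length ∧ i = x.length + 1) := by
        split_ifs at hij <;> omega
      rcases this with ⟨rfl, rfl⟩ | ⟨rfl, rfl⟩
      · exact ⟨hi, hj⟩
      · exact ⟨hj, hi⟩
    · simp only [Finset.mem_image]
      rintro _ ⟨i, hi, rfl⟩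
      have := hlt i hi
      simp only [List.length_append, List.length_cons, hf] at this ⊢
      split_ifs <;> omega
    · simp only [Finset.mem_image]
      rintro _ ⟨i, hi, rfl⟩ _ ⟨j, hj, rfl⟩ hij
      have hlj := hlt j hj
      have hij' : i < j := by
        simp only [hf] at hij
        split_ifs at hij <;> omega
      have hg := (hA i hi j hj hij').mono
        (i' := if i = x.length + 1 then x.length else i)
        (j' := if j = x.length then x.length + 2 else j + 1)
        (by split_ifs <;> omega) (by split_ifs <;> omega)
        (by simp only [List.length_append, List.length_cons] at hlj ⊢; split_ifs <;> omega)
      have := hg.merge hk (by split_ifs <;> omega) (by split_ifs <;> omega)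
      convert this using 1
      · simp only [hf]; split_ifs <;> omega
      · simp only [hf]; split_ifs <;> omega

lemma HasMarks.split {φ : α → M} {x y : List α} {a b k : α} (hk : LetterRel φ a b k) {N : ℕ}
    (h : HasMarks φ N (x ++ k :: y)) : HasMarks φ N (x ++ a :: b :: y) := by
  obtain ⟨A, rfl, hlt, hA⟩ := h
  obtain ⟨hk, hab | hab⟩ := hk
  · set f : ℕ → ℕ := fun i => if i ≤ x.length then i else i + 1 with hf
    refine ⟨A.image f, Finset.card_image_of_injective _ ?_, ?_, ?_⟩
    · intro i j hij
      simp only [hf] at hij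
      split_ifs at hij <;> omega
    · simp only [Finset.mem_image]
      rintro _ ⟨i, hi, rfl⟩
      have := hlt i hi
      simp only [List.length_append, List.length_cons, hf] at this ⊢
      split_ifs <;> omega
    · simp only [Finset.mem_image]
      rintro _ ⟨i, hi, rfl⟩ _ ⟨j, hj, rfl⟩ hij
      have hij' : i < j := by
        simp only [hf] at hij
        split_ifs at hij <;> omega
      have hg := (hA i hi j hj hij').split hk
      by_cases hjn : j = x.length
      · subst hjn
        simp only [hf, le_refl, if_true, if_pos hij'.le]
        refine GoodFactor.shrink_right hab hij'.le ?_
        simpa [hij'.le] using hg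
      · convert hg using 1
        simp only [hf]; split_ifs <;> omega
  · set f : ℕ → ℕ := fun i => if i < x.length then i else i + 1 with hf
    refine ⟨A.image f, Finset.card_image_of_injective _ ?_, ?_, ?_⟩
    · intro i j hij
      simp only [hf] at hij
      split_ifs at hij <;> omega
    · simp only [Finset.mem_image]
      rintro _ ⟨i, hi, rfl⟩
      have := hlt i hi
      simp only [List.length_append, List.length_cons, hf] at this ⊢
      split_ifs <;> omega
    · simp only [Finset.mem_image]
      rintro _ ⟨i, hi, rfl⟩ _ ⟨j, hj, rfl⟩ hij
      have hij' : i < j := by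
        simp only [hf] at hij
        split_ifs at hij <;> omega
      have hg := (hA i hi j hj hij').split hk
      have hfj : f j + 1 = if j + 1 ≤ x.length then j + 1 else j + 1 + 1 := by
        simp only [hf]; split_ifs <;> omega
      rw [← hfj] at hg
      by_cases hin : i = x.length
      · subst hin
        have hfi : f x.length = x.length + 1 := by simp [hf]
        rw [hfi]
        refine GoodFactor.shrink_left hab (by omega) ?_
        simpa using hg
      · convert hg using 1
        simp only [hf]; split_ifs <;> omega

/-- Powers of a nonempty word of idempotent value carry a mark at the start of each copy. -/
lemma hasMarks_replicate {φ : α → M} {z : List α} (hz : z ≠ [])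
    (hε : listVal φ z * listVal φ z = listVal φ z) (N : ℕ) :
    HasMarks φ N (List.replicate N z).flatten := by
  have hpos : 0 < z.length := List.length_pos_iff.2 hz
  have hpow : ∀ t, listVal φ z * listVal φ (List.replicate t z).flatten = listVal φ z := by
    intro t
    induction t with
    | zero => simp
    | succ t ih => rw [List.replicate_succ, List.flatten_cons, listVal_append, ← mul_assoc, hε, ih]
  have hlen : ∀ t, (List.replicate t z).flatten.length = t * z.length := by
    intro t
    simp [List.length_flatten]
  refine ⟨(Finset.range N).image (· * z.length), ?_, ?_, ?_⟩
  · rw [Finset.card_image_of_injective _ (fun s t h => Nat.eq_of_mul_eq_mul_right hpos h), Finset.card_range]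
  · simp only [Finset.mem_image, Finset.mem_range]
    rintro _ ⟨t, ht, rfl⟩
    rw [hlen]
    exact Nat.mul_lt_mul_of_pos_right ht hpos
  · simp only [Finset.mem_image, Finset.mem_range]
    rintro _ ⟨s, hs, rfl⟩ _ ⟨t, ht, rfl⟩ hst
    have hst' : s < t := lt_of_mul_lt_mul_right hst (Nat.zero_le _)
    have hle : (s + 1) * z.length ≤ t * z.length := Nat.mul_le_mul_right _ hst'
    have hle' : t * z.length < N * z.length := Nat.mul_lt_mul_of_pos_right ht hpos
    have hg : GoodFactor φ (List.replicate N z).flatten (s * z.length) ((s + 1) * z.length) := by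
      refine ⟨(List.replicate s z).flatten, z, (List.replicate (N - s - 1) z).flatten, ?_,
        hlen s, by rw [hlen]; ring, ?_⟩
      · obtain ⟨r, rfl⟩ : ∃ r, N = s + (r + 1) := ⟨N - s - 1, by omega⟩
        rw [List.replicate_add, List.flatten_append, List.replicate_succ, List.flatten_cons]
        congr 4
        omega
      · rw [hpow, hpow, hε]
    exact hg.mono le_rfl (by omega) (by rw [hlen]; omega)

end ListValues

section FreeIdempotentGenerated

variable {S : Type*} [Semigroup S]

/-- The letters of `E⁺` valued in `IG(E)` with an identity adjoined. -/
def letterVal (e : IdemE S) : WithOne (IG S) := (igBar (FreeSemigroup.of e) : IG S)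

lemma igBar_mul (v w : FreeSemigroup (IdemE S)) : igBar (v * w) = igBar v * igBar w := rfl

lemma wordList_of (e : IdemE S) : wordList (FreeSemigroup.of e) = [e] := rfl

lemma wordList_mul (v w : FreeSemigroup (IdemE S)) :
    wordList (v * w) = wordList v ++ wordList w := rfl

lemma listVal_wordList (w : FreeSemigroup (IdemE S)) :
    listVal letterVal (wordList w) = (igBar w : IG S) := by
  induction w using FreeSemigroup.recOnMul with
  | ih1 e => simp [wordList_of, letterVal]
  | ih2 e w h1 h2 => rw [wordList_mul, listVal_append, h1, h2, igBar_mul, WithOne.coe_mul]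

lemma igBar_of_mul_of {a b k : IdemE S} (h : BasicPair a b) (hk : (k : S) = a * b) :
    igBar (FreeSemigroup.of a) * igBar (FreeSemigroup.of b) = igBar (FreeSemigroup.of k) :=
  (Con.eq _).2 (ConGen.Rel.of _ _ ⟨a, b, k, h, hk, rfl, rfl⟩)

lemma letterVal_mul {a b k : IdemE S} (h : BasicPair a b) (hk : (k : S) = a * b) :
    letterVal a * letterVal b = letterVal k := by
  simp only [letterVal, ← WithOne.coe_mul, igBar_of_mul_of h hk]

lemma letterVal_idem (a : IdemE S) : letterVal a * letterVal a = letterVal a :=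
  letterVal_mul (.inl a.2) a.2.symm

lemma letterRel_of_basicPair {a b k : IdemE S} (h : BasicPair a b) (hk : (k : S) = a * b) :
    LetterRel letterVal a b k := by
  refine ⟨letterVal_mul h hk, ?_⟩
  have h' : BasicPair b a := by
    rcases h with h | h | h | h
    exacts [.inr (.inr (.inr h)), .inr (.inr (.inl h)), .inr (.inl h), .inl h]
  rcases id h with h₁ | h₁ | h₁ | h₁
  · left
    rw [letterVal_mul h h₁.symm, letterVal_idem]
  · right
    rw [mul_assoc, letterVal_mul h h₁.symm, letterVal_idem]
  · left
    rw [mul_assoc, letterVal_mul h' h₁.symm, letterVal_idem]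
  · right
    rw [letterVal_mul h' h₁.symm, letterVal_idem]

/-- A property of words preserved by the defining relations is a property of elements. -/
lemma iff_of_igBar_eq {Q : List (IdemE S) → Prop}
    (hQ : ∀ x y (a b k : IdemE S), BasicPair a b → (k : S) = a * b →
      (Q (x ++ a :: b :: y) ↔ Q (x ++ k :: y)))
    {w w' : FreeSemigroup (IdemE S)} (h : igBar w = igBar w') :
    Q (wordList w) ↔ Q (wordList w') := by
  have key : ∀ x y, Q (x ++ (wordList w ++ y)) ↔ Q (x ++ (wordList w' ++ y)) := by
    have hrel : ConGen.Rel (fun u v : FreeSemigroup (IdemE S) => igRelBase u v) w w' :=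
      (Con.eq _).1 h
    clear h
    induction hrel with
    | of u v h =>
      obtain ⟨a, b, k, hab, hk, rfl, rfl⟩ := h
      intro x y
      exact hQ x y a b k hab hk
    | refl u => exact fun _ _ => Iff.rfl
    | symm _ ih => exact fun x y => (ih x y).symm
    | trans _ _ ih₁ ih₂ => exact fun x y => (ih₁ x y).trans (ih₂ x y)
    | mul _ _ ih₁ ih₂ =>
      intro x y
      simp only [wordList_mul, List.append_assoc]
      refine (ih₁ x _).trans ?_
      rw [← List.append_assoc, ← List.append_assoc x]
      exact ih₂ _ y
  simpa using key [] []

lemma exists_wordList_eq {l : List (IdemE S)} (hl : l ≠ []) :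
    ∃ w : FreeSemigroup (IdemE S), wordList w = l := by
  cases l with
  | nil => exact absurd rfl hl
  | cons a l => exact ⟨⟨a, l⟩, rfl⟩

lemma igBar_eq_of_listVal_eq {v w : FreeSemigroup (IdemE S)}
    (h : listVal letterVal (wordList v) = listVal letterVal (wordList w)) :
    igBar v = igBar w := by
  rw [listVal_wordList, listVal_wordList] at h
  exact WithOne.coe_inj.1 h

lemma hasSeed_of_idempotent {z : FreeSemigroup (IdemE S)} (hz : igBar z * igBar z = igBar z) :
    HasSeed letterVal (igBar z : WithOne (IG S)) := by
  have hne : wordList z ≠ [] := List.cons_ne_nil _ _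
  have hε : listVal letterVal (wordList z) * listVal letterVal (wordList z) =
      listVal letterVal (wordList z) := by
    rw [listVal_wordList, ← WithOne.coe_mul, hz]
  set N := (wordList z).length + 1 with hN
  obtain ⟨w, hw⟩ := exists_wordList_eq (l := (List.replicate N (wordList z)).flatten)
    (by rw [hN, List.replicate_succ, List.flatten_cons]; simp [hne])
  have hval : listVal letterVal (wordList w) = listVal letterVal (wordList z) := by
    rw [hw]
    have hpow : ∀ t, listVal letterVal (List.replicate (t + 1) (wordList z)).flatten =
        listVal letterVal (wordList z) := by
      intro t
      induction t with
      | zero => simp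
      | succ t ih => rw [List.replicate_succ, List.flatten_cons, listVal_append, ih, hε]
    exact hpow _
  have hinv := iff_of_igBar_eq
    (Q := fun l => HasSeed letterVal (listVal letterVal l) ∨ HasMarks letterVal N l)
    (fun x y a b k hab hk => by
      have hrel := letterRel_of_basicPair hab hk
      have hv : listVal letterVal (x ++ a :: b :: y) = listVal letterVal (x ++ k :: y) := by
        simp [← hrel.1, mul_assoc]
      rw [hv]
      exact ⟨fun h => h.elim .inl fun h => h.merge hrel.1, fun h => h.imp id fun h => h.split hrel⟩)
    (igBar_eq_of_listVal_eq hval)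
  rw [← listVal_wordList]
  rcases hinv.1 (.inr (hw ▸ hasMarks_replicate hne hε N)) with h | ⟨A, hA, hlt, -⟩
  · exact h
  · have := Finset.card_le_card (fun i hi => Finset.mem_range.2 (hlt i hi))
    rw [hA, Finset.card_range] at this
    omega

lemma fixesPrefix_iff_of_igBar_eq (ε : WithOne (IG S)) {w w' : FreeSemigroup (IdemE S)}
    (h : igBar w = igBar w') :
    FixesPrefix letterVal ε (wordList w) ↔ FixesPrefix letterVal ε (wordList w') :=
  iff_of_igBar_eq (fun x y _ _ _ hab hk => fixesPrefix_rel (letterRel_of_basicPair hab hk) ε x y) h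

lemma fixesSuffix_iff_of_igBar_eq (ε : WithOne (IG S)) {w w' : FreeSemigroup (IdemE S)}
    (h : igBar w = igBar w') :
    FixesSuffix letterVal ε (wordList w) ↔ FixesSuffix letterVal ε (wordList w') :=
  iff_of_igBar_eq (fun x y _ _ _ hab hk => fixesSuffix_rel (letterRel_of_basicPair hab hk) ε x y) h

lemma HasSeed.exists_word {ε : WithOne (IG S)} (h : HasSeed letterVal ε) :
    ∃ w : FreeSemigroup (IdemE S), listVal letterVal (wordList w) = ε ∧
      FixesPrefix letterVal ε (wordList w) ∧ FixesSuffix letterVal ε (wordList w) := by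
  obtain ⟨u, k, v, rfl, hk⟩ := h
  obtain ⟨w, hw⟩ := exists_wordList_eq (l := u ++ k :: v) (by simp)
  have h₁ : listVal letterVal (u ++ k :: v) * (listVal letterVal u * letterVal k) =
      listVal letterVal u * letterVal k := by
    have := congrArg (fun t => listVal letterVal u * t) hk
    simpa [mul_assoc] using this
  have h₂ : letterVal k * listVal letterVal v * listVal letterVal (u ++ k :: v) =
      letterVal k * listVal letterVal v := by
    have := congrArg (fun t => t * listVal letterVal v) hk
    simpa [mul_assoc] using this
  rw [← hw] at h₁ h₂ ⊢
  refine ⟨w, rfl, ⟨u, k, v, hw, ⟨letterVal k * listVal letterVal v, ?_⟩, h₁⟩,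
    ⟨u, k, v, hw, ⟨listVal letterVal u * letterVal k, ?_⟩, h₂⟩⟩ <;>
  simpa [mul_assoc] using hk

lemma fixesPrefix_of_mul_eq {ε : IG S} (hε : ε * ε = ε) {w : FreeSemigroup (IdemE S)}
    (h : ε * igBar w = igBar w) : FixesPrefix letterVal (ε : WithOne (IG S)) (wordList w) := by
  obtain ⟨z, rfl⟩ : ∃ z, igBar z = ε := Quotient.exists_rep ε
  obtain ⟨z', hz', ⟨u, k, v, hl, hy, hk⟩, -⟩ := (hasSeed_of_idempotent hε).exists_word
  rw [listVal_wordList, WithOne.coe_inj] at hz'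
  rw [← fixesPrefix_iff_of_igBar_eq _ (show igBar (z' * w) = igBar w by rw [igBar_mul, hz', h])]
  exact ⟨u, k, v ++ wordList w, by rw [wordList_mul, hl]; simp, hy, hk⟩

lemma fixesSuffix_of_mul_eq {ε : IG S} (hε : ε * ε = ε) {w : FreeSemigroup (IdemE S)}
    (h : igBar w * ε = igBar w) : FixesSuffix letterVal (ε : WithOne (IG S)) (wordList w) := by
  obtain ⟨z, rfl⟩ : ∃ z, igBar z = ε := Quotient.exists_rep ε
  obtain ⟨z', hz', -, ⟨u, k, v, hl, hy, hk⟩⟩ := (hasSeed_of_idempotent hε).exists_word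
  rw [listVal_wordList, WithOne.coe_inj] at hz'
  rw [← fixesSuffix_iff_of_igBar_eq _ (show igBar (w * z') = igBar w by rw [igBar_mul, hz', h])]
  exact ⟨wordList w ++ u, k, v, by rw [wordList_mul, hl]; simp, hy, hk⟩

lemma mul_igBar_eq_of_prefix {ε : IG S} {w : FreeSemigroup (IdemE S)}
    (h : FixesPrefix letterVal (ε : WithOne (IG S)) (wordList w)) : ε * igBar w = igBar w := by
  obtain ⟨u, k, v, hl, -, hk⟩ := h
  rw [← WithOne.coe_inj, WithOne.coe_mul, ← listVal_wordList, hl]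
  have := congrArg (fun t => t * listVal letterVal v) hk
  simpa [mul_assoc] using this

lemma igBar_mul_eq_of_suffix {ε : IG S} {w : FreeSemigroup (IdemE S)}
    (h : FixesSuffix letterVal (ε : WithOne (IG S)) (wordList w)) : igBar w * ε = igBar w := by
  obtain ⟨u, k, v, hl, -, hk⟩ := h
  rw [← WithOne.coe_inj, WithOne.coe_mul, ← listVal_wordList, hl]
  have := congrArg (fun t => listVal letterVal u * t) hk
  simpa [mul_assoc] using this

lemma exists_coe_eq_coe_mul {T : Type*} [Semigroup T] (a : T) (x : WithOne T) :
    ∃ c : T, (c : WithOne T) = a * x := by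
  induction x using WithOne.recOneCoe with
  | one => exact ⟨a, by simp⟩
  | coe b => exact ⟨a * b, by simp⟩

lemma exists_coe_eq_mul_coe {T : Type*} [Semigroup T] (a : T) (x : WithOne T) :
    ∃ c : T, (c : WithOne T) = x * a := by
  induction x using WithOne.recOneCoe with
  | one => exact ⟨a, by simp⟩
  | coe b => exact ⟨b * a, by simp⟩

lemma fixesPrefix_of_mul {ε : WithOne (IG S)} {v q : FreeSemigroup (IdemE S)}
    (hq : IsRegularElem (igBar q)) (hvq : ¬ IsRegularElem (igBar (v * q)))
    (h : FixesPrefix letterVal ε (wordList (v * q))) : FixesPrefix letterVal ε (wordList v) := by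
  obtain ⟨u, k, r, hl, ⟨y, hy⟩, hk⟩ := h
  rw [wordList_mul] at hl
  rcases append_eq_append_cons hl with ⟨u', rfl, hr⟩ | ⟨r', hr, -⟩
  · exfalso
    apply hvq
    obtain ⟨c, hc⟩ := hq
    obtain ⟨d, hd⟩ := exists_coe_eq_coe_mul c (listVal letterVal u' * y)
    refine ⟨d, WithOne.coe_inj.1 ?_⟩
    have hc' := WithOne.coe_inj.2 hc
    simp only [WithOne.coe_mul] at hc'
    have hq' : listVal letterVal u' * y * ((igBar v : IG S) * (igBar q : IG S)) =
        ((igBar q : IG S) : WithOne (IG S)) := by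
      rw [← listVal_wordList q, ← listVal_wordList v, hr]
      have := congrArg (fun t => listVal letterVal u' * t * listVal letterVal r) hy
      simpa [mul_assoc] using this
    simp only [igBar_mul, WithOne.coe_mul, hd]
    rw [mul_assoc _ (_ * _ : WithOne (IG S)), mul_assoc (c : WithOne (IG S)), hq', mul_assoc,
      ← mul_assoc (igBar q : WithOne (IG S)), hc']
  · exact ⟨u, k, r', hr, ⟨y, hy⟩, hk⟩

lemma fixesSuffix_of_mul {ε : WithOne (IG S)} {v q : FreeSemigroup (IdemE S)}
    (hq : IsRegularElem (igBar q)) (hvq : ¬ IsRegularElem (igBar (q * v)))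
    (h : FixesSuffix letterVal ε (wordList (q * v))) : FixesSuffix letterVal ε (wordList v) := by
  obtain ⟨u, k, r, hl, ⟨y, hy⟩, hk⟩ := h
  rw [wordList_mul] at hl
  rcases append_eq_append_cons hl with ⟨u', rfl, hr⟩ | ⟨r', hr, rfl⟩
  · exact ⟨u', k, r, hr, ⟨y, hy⟩, hk⟩
  · exfalso
    apply hvq
    obtain ⟨c, hc⟩ := hq
    obtain ⟨d, hd⟩ := exists_coe_eq_mul_coe c (y * listVal letterVal r')
    refine ⟨d, WithOne.coe_inj.1 ?_⟩
    have hc' := WithOne.coe_inj.2 hc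
    simp only [WithOne.coe_mul] at hc'
    have hq' : (igBar q : IG S) * (igBar v : IG S) * (y * listVal letterVal r') =
        ((igBar q : IG S) : WithOne (IG S)) := by
      rw [← listVal_wordList q, ← listVal_wordList v, hr]
      have := congrArg (fun t => listVal letterVal u * t * listVal letterVal r') hy
      simpa [mul_assoc] using this
    simp only [igBar_mul, WithOne.coe_mul, hd]
    rw [← mul_assoc (_ * _ : WithOne (IG S)) (y * _), hq', ← mul_assoc, hc']

end FreeIdempotentGenerated

section Blocks

lemma blockProd_succ_left {T : Type*} [Semigroup T] (p : ℕ → T) (i k : ℕ) :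
    blockProd p i (k + 1) = p i * blockProd p (i + 1) k := by
  induction k with
  | zero => rfl
  | succ k ih =>
    rw [blockProd, ih, blockProd, mul_assoc]
    congr 3
    omega

variable {S : Type*} [Semigroup S]

lemma fixesPrefix_first {ε : WithOne (IG S)} {p : ℕ → FreeSemigroup (IdemE S)} {n : ℕ}
    (hreg : ∀ i, 1 ≤ i → i ≤ n + 1 → IsRegularElem (igBar (p i)))
    (hmin : ∀ j, 1 < j → j ≤ n + 1 → ¬ IsRegularElem (igBar (blockProd p 1 (j - 1))))
    (h : FixesPrefix letterVal ε (wordList (blockProd p 1 n))) :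
    FixesPrefix letterVal ε (wordList (p 1)) := by
  induction n with
  | zero => exact h
  | succ n ih =>
    refine ih (fun i h₁ h₂ => hreg i h₁ (by omega)) (fun j h₁ h₂ => hmin j h₁ (by omega)) ?_
    exact fixesPrefix_of_mul (hreg _ (by omega) (by omega)) (hmin (n + 2) (by omega) le_rfl) h

lemma fixesSuffix_last {ε : WithOne (IG S)} {p : ℕ → FreeSemigroup (IdemE S)} {i n : ℕ}
    (hreg : ∀ t, i ≤ t → t ≤ i + n → IsRegularElem (igBar (p t)))
    (hmin : ∀ t, i ≤ t → t < i + n → ¬ IsRegularElem (igBar (blockProd p t (i + n - t))))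
    (h : FixesSuffix letterVal ε (wordList (blockProd p i n))) :
    FixesSuffix letterVal ε (wordList (p (i + n))) := by
  induction n generalizing i with
  | zero => exact h
  | succ n ih =>
    have hin : i + (n + 1) = i + 1 + n := by omega
    have h₀ := hmin i le_rfl (by omega)
    rw [show i + (n + 1) - i = n + 1 by omega, blockProd_succ_left] at h₀
    rw [blockProd_succ_left] at h
    rw [hin] at hreg hmin ⊢
    refine ih (fun t h₁ h₂ => hreg t (by omega) h₂) (fun t h₁ h₂ => hmin t (by omega) h₂) ?_
    exact fixesSuffix_of_mul (hreg i le_rfl (by omega)) h₀ h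

lemma mul_igBar_blockProd {ε : IG S} {p : ℕ → FreeSemigroup (IdemE S)}
    (h : ε * igBar (p 1) = igBar (p 1)) (n : ℕ) :
    ε * igBar (blockProd p 1 n) = igBar (blockProd p 1 n) := by
  induction n with
  | zero => exact h
  | succ n ih => rw [blockProd, igBar_mul, ← mul_assoc, ih]

lemma igBar_blockProd_mul {ε : IG S} {p : ℕ → FreeSemigroup (IdemE S)} {i n : ℕ}
    (h : igBar (p (i + n)) * ε = igBar (p (i + n))) :
    igBar (blockProd p i n) * ε = igBar (blockProd p i n) := by
  cases n with
  | zero => exact h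
  | succ n => rw [blockProd, igBar_mul, mul_assoc, h]

end Blocks

lemma GreenR.mul_eq_iff {T : Type*} [Semigroup T] {a b : T} (h : GreenR a b) (ε : T) :
    ε * a = a ↔ ε * b = b := by
  rcases h with rfl | ⟨x, y, hx, hy⟩
  · rfl
  · exact ⟨fun h => by rw [← hx, ← mul_assoc, h], fun h => by rw [← hy, ← mul_assoc, h]⟩

lemma GreenL.mul_eq_iff {T : Type*} [Semigroup T] {a b : T} (h : GreenL a b) (ε : T) :
    a * ε = a ↔ b * ε = b := by
  rcases h with rfl | ⟨x, y, hx, hy⟩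
  · rfl
  · exact ⟨fun h => by rw [← hx, mul_assoc, h], fun h => by rw [← hy, mul_assoc, h]⟩

theorem stmt18 {S : Type*} [Semigroup S] [Finite (IdemE S)]
    (w : FreeSemigroup (IdemE S)) (m : ℕ) (p : ℕ → FreeSemigroup (IdemE S))
    (hp : IsMinRFact w m p) :
    (GreenR (igBar (FreeSemigroup.of (firstLetter (p 1)))) (igBar (p 1)) →
      RTilde (igBar w) (igBar (FreeSemigroup.of (firstLetter (p 1))))) ∧
    (GreenL (igBar (FreeSemigroup.of (lastLetter (p m)))) (igBar (p m)) →
      LTilde (igBar w) (igBar (FreeSemigroup.of (lastLetter (p m))))) := by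
  obtain ⟨⟨hm, rfl, hreg⟩, hmin⟩ := hp
  obtain ⟨n, rfl⟩ : ∃ n, m = n + 1 := ⟨m - 1, by omega⟩
  rw [Nat.add_sub_cancel]
  constructor
  · intro hR ε hε
    rw [hR.mul_eq_iff]
    refine ⟨fun h => ?_, fun h => mul_igBar_blockProd h n⟩
    exact mul_igBar_eq_of_prefix (fixesPrefix_first hreg (fun j h₁ h₂ => hmin 1 j le_rfl h₁ h₂)
      (fixesPrefix_of_mul_eq hε h))
  · intro hL ε hε
    rw [hL.mul_eq_iff, Nat.add_comm n 1] at *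
    refine ⟨fun h => ?_, igBar_blockProd_mul⟩
    exact igBar_mul_eq_of_suffix (fixesSuffix_last hreg
      (fun t h₁ h₂ => hmin t (1 + n) h₁ h₂ le_rfl) (fixesSuffix_of_mul_eq hε h))
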